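/- Let r_d, r_f ∈ ℝ, σ > 0, x₀ > 0 and T > 0. Define for X > 0 and t ≤ T: V_f(X,t) = e^{r_d t} X^{−1} N(−d₁) + x₀^{−1} e^{r_f t} N(d₂), where d₁ = [ln( x₀^{−1} e^{r_f t} / (e^{r_d t} X^{−1}) ) − (σ²/2)(T−t)] / (σ√(T−t)) and d₂ = [ln( x₀^{−1} e^{r_f t} / (e^{r_d t} X^{−1}) ) + (σ²/2)(T−t)] / (σ√(T−t)). Then for all X > 0 and t < T, ∂V_f/∂t + (σ²/2)X² ∂²V_f/∂X² + (σ² + r_d − r_f)X ∂V_f/∂X − r_f V_f = 0, and V_f(X,T) = max( e^{r_d T} X^{−1}, x₀^{−1} e^{r_f T} ). -/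

import Mathlib

open MeasureTheory Filter Topology

/-- The standard normal cumulative distribution function. -/
noncomputable def normCDF (d : ℝ) : ℝ :=
  (Real.sqrt (2 * Real.pi))⁻¹ * ∫ y in Set.Iio d, Real.exp (-y ^ 2 / 2)

/-- The quantity `d₁` in the price of the savings plan providing a choice of indexing. -/
noncomputable def d₁ (rd rf σ x₀ T : ℝ) (X t : ℝ) : ℝ :=
  (Real.log (x₀⁻¹ * Real.exp (rf * t) / (Real.exp (rd * t) * X⁻¹))
      - σ ^ 2 / 2 * (T - t)) / (σ * Real.sqrt (T - t))

/-- The quantity `d₂` in the price of the savings plan providing a choice of indexing. -/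
noncomputable def d₂ (rd rf σ x₀ T : ℝ) (X t : ℝ) : ℝ :=
  (Real.log (x₀⁻¹ * Real.exp (rf * t) / (Real.exp (rd * t) * X⁻¹))
      + σ ^ 2 / 2 * (T - t)) / (σ * Real.sqrt (T - t))

lemma integrable_exp_neg_sq_div_two : Integrable fun y : ℝ => Real.exp (-y ^ 2 / 2) := by
  convert integrable_exp_neg_mul_sq (b := 1 / 2) (by norm_num) using 3
  ring

lemma integral_exp_neg_sq_div_two :
    ∫ y : ℝ, Real.exp (-y ^ 2 / 2) = Real.sqrt (2 * Real.pi) := by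
  have h := integral_gaussian (1 / 2)
  rw [show Real.pi / (1 / 2) = 2 * Real.pi by ring] at h
  rw [← h]
  congr 1 with y
  ring_nf

lemma sqrt_two_mul_pi_pos : 0 < Real.sqrt (2 * Real.pi) :=
  Real.sqrt_pos.2 (by positivity)

lemma hasDerivAt_normCDF (d : ℝ) :
    HasDerivAt normCDF ((Real.sqrt (2 * Real.pi))⁻¹ * Real.exp (-d ^ 2 / 2)) d := by
  have hi := integrable_exp_neg_sq_div_two
  have hc : Continuous fun y : ℝ => Real.exp (-y ^ 2 / 2) := by fun_prop
  have heq : normCDF = fun d => (Real.sqrt (2 * Real.pi))⁻¹ *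
      ((∫ y in Set.Iic 0, Real.exp (-y ^ 2 / 2)) + ∫ y in (0 : ℝ)..d, Real.exp (-y ^ 2 / 2)) := by
    ext d
    rw [normCDF, ← integral_Iic_eq_integral_Iio,
      ← intervalIntegral.integral_Iic_sub_Iic hi.integrableOn hi.integrableOn]
    ring
  rw [heq]
  exact ((intervalIntegral.integral_hasDerivAt_right (hi.intervalIntegrable)
    (hc.stronglyMeasurableAtFilter _ _) hc.continuousAt).const_add _).const_mul _

lemma normCDF_neg (d : ℝ) : normCDF (-d) = 1 - normCDF d := by
  have hi := integrable_exp_neg_sq_div_two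
  have hneg : ∫ y in Set.Iio (-d), Real.exp (-y ^ 2 / 2)
      = ∫ y in Set.Ici d, Real.exp (-y ^ 2 / 2) := by
    rw [← integral_Iic_eq_integral_Iio, integral_Ici_eq_integral_Ioi]
    have h := integral_comp_neg_Iic (-d) fun y : ℝ => Real.exp (-y ^ 2 / 2)
    rw [neg_neg] at h
    rw [← h]
    congr 1 with y
    rw [neg_sq]
  have hadd := integral_add_compl (measurableSet_Iio (a := d)) hi
  rw [Set.compl_Iio, integral_exp_neg_sq_div_two] at hadd
  have hs := sqrt_two_mul_pi_pos.ne'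
  rw [normCDF, normCDF, hneg]
  rw [← mul_right_inj' hs, mul_sub, mul_inv_cancel_left₀ hs, mul_inv_cancel_left₀ hs]
  linarith

lemma normCDF_zero : normCDF 0 = 1 / 2 := by
  have h := normCDF_neg 0
  rw [neg_zero] at h
  linarith

lemma tendsto_normCDF_atTop : Tendsto normCDF atTop (𝓝 1) := by
  have h := (aecover_Iio (μ := volume)
    (tendsto_id (α := ℝ) (x := atTop))).integral_tendsto_of_countably_generated
      integrable_exp_neg_sq_div_two
  rw [integral_exp_neg_sq_div_two] at h
  replace h := h.const_mul (Real.sqrt (2 * Real.pi))⁻¹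
  rwa [inv_mul_cancel₀ sqrt_two_mul_pi_pos.ne'] at h

lemma tendsto_normCDF_atBot : Tendsto normCDF atBot (𝓝 0) := by
  have h := (tendsto_normCDF_atTop.comp tendsto_neg_atBot_atTop).const_sub 1
  rw [sub_self] at h
  refine h.congr fun d => ?_
  simp [normCDF_neg]

section Price

variable {rd rf σ x₀ T X t : ℝ}

lemma log_indexing_ratio (hx₀ : 0 < x₀) (hX : 0 < X) :
    Real.log (x₀⁻¹ * Real.exp (rf * t) / (Real.exp (rd * t) * X⁻¹))
      = Real.log X - Real.log x₀ + (rf - rd) * t := by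
  rw [Real.log_div (by positivity) (by positivity), Real.log_mul (by positivity) (by positivity),
    Real.log_mul (by positivity) (by positivity), Real.log_inv, Real.log_inv, Real.log_exp,
    Real.log_exp]
  ring

lemma d₂_eq_d₁_add (hσ : 0 < σ) (ht : t < T) :
    d₂ rd rf σ x₀ T X t = d₁ rd rf σ x₀ T X t + σ * Real.sqrt (T - t) := by
  have hs : 0 < Real.sqrt (T - t) := Real.sqrt_pos.2 (by linarith)
  have hsq : Real.sqrt (T - t) ^ 2 = T - t := Real.sq_sqrt (by linarith)
  rw [d₁, d₂]
  field_simp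
  rw [hsq]
  ring

/-- The two Gaussian densities in the price, weighted by the two accumulated values, agree. -/
lemma accumulated_mul_exp_d₁_eq (hσ : 0 < σ) (hx₀ : 0 < x₀) (hX : 0 < X) (ht : t < T) :
    Real.exp (rd * t) * X⁻¹ * Real.exp (-d₁ rd rf σ x₀ T X t ^ 2 / 2)
      = x₀⁻¹ * Real.exp (rf * t) * Real.exp (-d₂ rd rf σ x₀ T X t ^ 2 / 2) := by
  have hs : 0 < Real.sqrt (T - t) := Real.sqrt_pos.2 (by linarith)
  have hsq : Real.sqrt (T - t) ^ 2 = T - t := Real.sq_sqrt (by linarith)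
  have h₁ : d₁ rd rf σ x₀ T X t * (σ * Real.sqrt (T - t))
      = Real.log X - Real.log x₀ + (rf - rd) * t - σ ^ 2 / 2 * (T - t) := by
    rw [d₁, log_indexing_ratio hx₀ hX, div_mul_cancel₀ _ (by positivity)]
  rw [d₂_eq_d₁_add hσ ht, ← Real.exp_log hX, ← Real.exp_log hx₀, ← Real.exp_neg, ← Real.exp_neg,
    ← Real.exp_add, ← Real.exp_add, ← Real.exp_add, ← Real.exp_add, Real.exp_log hX,
    Real.exp_log hx₀]
  congr 1
  linear_combination h₁ + σ ^ 2 / 2 * hsq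

lemma hasDerivAt_d₁_fst (hx₀ : 0 < x₀) (hX : 0 < X) :
    HasDerivAt (fun y => d₁ rd rf σ x₀ T y t) (X⁻¹ / (σ * Real.sqrt (T - t))) X := by
  have h := ((((Real.hasDerivAt_log hX.ne').sub_const (Real.log x₀)).add_const
    ((rf - rd) * t)).sub_const (σ ^ 2 / 2 * (T - t))).div_const (σ * Real.sqrt (T - t))
  refine h.congr_of_eventuallyEq ?_
  filter_upwards [lt_mem_nhds hX] with y hy
  rw [d₁, log_indexing_ratio hx₀ hy]

lemma hasDerivAt_d₂_fst (hσ : 0 < σ) (hx₀ : 0 < x₀) (hX : 0 < X) (ht : t < T) :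
    HasDerivAt (fun y => d₂ rd rf σ x₀ T y t) (X⁻¹ / (σ * Real.sqrt (T - t))) X := by
  simp only [d₂_eq_d₁_add hσ ht]
  exact (hasDerivAt_d₁_fst hx₀ hX).add_const _

lemma hasDerivAt_volatility_snd (ht : t < T) :
    HasDerivAt (fun u => σ * Real.sqrt (T - u)) (-(σ / (2 * Real.sqrt (T - t)))) t := by
  have h := (((hasDerivAt_id t).const_sub T).sqrt (by simp only [id]; linarith)).const_mul σ
  refine h.congr_deriv ?_
  simp only [id]
  ring

lemma differentiableAt_d₁_snd (hσ : 0 < σ) (hx₀ : 0 < x₀) (hX : 0 < X) (ht : t < T) :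
    DifferentiableAt ℝ (fun u => d₁ rd rf σ x₀ T X u) t := by
  have hs : 0 < Real.sqrt (T - t) := Real.sqrt_pos.2 (by linarith)
  simp only [d₁, log_indexing_ratio hx₀ hX]
  exact DifferentiableAt.div (by fun_prop) (hasDerivAt_volatility_snd ht).differentiableAt
    (by positivity)

/-- The price of the savings plan providing a choice of indexing, in foreign currency. -/
noncomputable def indexingPrice (rd rf σ x₀ T X t : ℝ) : ℝ :=
  Real.exp (rd * t) * X⁻¹ * normCDF (-(d₁ rd rf σ x₀ T X t))
    + x₀⁻¹ * Real.exp (rf * t) * normCDF (d₂ rd rf σ x₀ T X t)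

lemma hasDerivAt_normCDF_neg_d₁ (hx₀ : 0 < x₀) (hX : 0 < X) :
    HasDerivAt (fun y => normCDF (-(d₁ rd rf σ x₀ T y t)))
      (-((Real.sqrt (2 * Real.pi))⁻¹ * Real.exp (-d₁ rd rf σ x₀ T X t ^ 2 / 2)
        * (X⁻¹ / (σ * Real.sqrt (T - t))))) X := by
  have h := (hasDerivAt_normCDF (-(d₁ rd rf σ x₀ T X t))).comp X
    (hasDerivAt_d₁_fst (rd := rd) (rf := rf) hx₀ hX).neg
  refine h.congr_deriv ?_
  rw [neg_sq]
  ring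

lemma hasDerivAt_indexingPrice_fst (hσ : 0 < σ) (hx₀ : 0 < x₀) (hX : 0 < X) (ht : t < T) :
    HasDerivAt (fun y => indexingPrice rd rf σ x₀ T y t)
      (-(Real.exp (rd * t) * (X ^ 2)⁻¹ * normCDF (-(d₁ rd rf σ x₀ T X t)))) X := by
  have h := (((hasDerivAt_inv hX.ne').const_mul (Real.exp (rd * t))).mul
    (hasDerivAt_normCDF_neg_d₁ (rd := rd) (rf := rf) (σ := σ) (T := T) (t := t) hx₀ hX)).add
    (((hasDerivAt_normCDF (d₂ rd rf σ x₀ T X t)).comp X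
      (hasDerivAt_d₂_fst hσ hx₀ hX ht)).const_mul (x₀⁻¹ * Real.exp (rf * t)))
  refine h.congr_deriv ?_
  linear_combination -(Real.sqrt (2 * Real.pi))⁻¹ * (X⁻¹ / (σ * Real.sqrt (T - t))) *
    accumulated_mul_exp_d₁_eq (rd := rd) (rf := rf) hσ hx₀ hX ht

lemma hasDerivAt_deriv_indexingPrice_fst (hσ : 0 < σ) (hx₀ : 0 < x₀) (hX : 0 < X) :
    HasDerivAt (fun y => -(Real.exp (rd * t) * (y ^ 2)⁻¹ * normCDF (-(d₁ rd rf σ x₀ T y t))))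
      (2 * Real.exp (rd * t) * (X ^ 3)⁻¹ * normCDF (-(d₁ rd rf σ x₀ T X t))
        + Real.exp (rd * t) * (X ^ 3)⁻¹ * ((Real.sqrt (2 * Real.pi))⁻¹ *
          Real.exp (-d₁ rd rf σ x₀ T X t ^ 2 / 2)) / (σ * Real.sqrt (T - t))) X := by
  have h := (((((hasDerivAt_pow 2 X).inv (by positivity)).const_mul (Real.exp (rd * t))).mul
    (hasDerivAt_normCDF_neg_d₁ (rd := rd) (rf := rf) (σ := σ) (T := T) (t := t) hx₀ hX))).neg
  refine h.congr_deriv ?_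
  simp only [Pi.inv_apply]
  field_simp
  ring

lemma hasDerivAt_indexingPrice_snd (hσ : 0 < σ) (hx₀ : 0 < x₀) (hX : 0 < X) (ht : t < T) :
    HasDerivAt (fun u => indexingPrice rd rf σ x₀ T X u)
      (rd * (Real.exp (rd * t) * X⁻¹ * normCDF (-(d₁ rd rf σ x₀ T X t)))
        + rf * (x₀⁻¹ * Real.exp (rf * t) * normCDF (d₂ rd rf σ x₀ T X t))
        - Real.exp (rd * t) * X⁻¹ * ((Real.sqrt (2 * Real.pi))⁻¹ *
          Real.exp (-d₁ rd rf σ x₀ T X t ^ 2 / 2)) * (σ / (2 * Real.sqrt (T - t)))) t := by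
  have hd₁ := (differentiableAt_d₁_snd (rd := rd) (rf := rf) hσ hx₀ hX ht).hasDerivAt
  set δ := deriv (fun u => d₁ rd rf σ x₀ T X u) t
  have hd₂ : HasDerivAt (fun u => d₂ rd rf σ x₀ T X u)
      (δ + -(σ / (2 * Real.sqrt (T - t)))) t := by
    refine (hd₁.add (hasDerivAt_volatility_snd ht)).congr_of_eventuallyEq ?_
    filter_upwards [gt_mem_nhds ht] with u hu using d₂_eq_d₁_add hσ hu
  have hexp (r : ℝ) : HasDerivAt (fun u => Real.exp (r * u)) (Real.exp (r * t) * (r * 1)) t :=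
    ((hasDerivAt_id t).const_mul r).exp
  have h := (((hexp rd).mul_const X⁻¹).mul
    ((hasDerivAt_normCDF (-(d₁ rd rf σ x₀ T X t))).comp t hd₁.neg)).add
    (((hexp rf).const_mul x₀⁻¹).mul ((hasDerivAt_normCDF (d₂ rd rf σ x₀ T X t)).comp t hd₂))
  refine h.congr_deriv ?_
  simp only [neg_sq, Function.comp_apply]
  linear_combination -(Real.sqrt (2 * Real.pi))⁻¹ * (δ - σ / (2 * Real.sqrt (T - t))) *
    accumulated_mul_exp_d₁_eq (rd := rd) (rf := rf) hσ hx₀ hX ht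

lemma tendsto_volatility : Tendsto (fun t => σ * Real.sqrt (T - t)) (𝓝[<] T) (𝓝 0) := by
  have h : Continuous fun t => σ * Real.sqrt (T - t) := by fun_prop
  simpa using (h.tendsto T).mono_left nhdsWithin_le_nhds

lemma tendsto_volatility_inv (hσ : 0 < σ) :
    Tendsto (fun t => (σ * Real.sqrt (T - t))⁻¹) (𝓝[<] T) atTop := by
  refine tendsto_inv_nhdsGT_zero.comp (tendsto_nhdsWithin_iff.2 ⟨tendsto_volatility, ?_⟩)
  filter_upwards [self_mem_nhdsWithin] with t ht
  exact mul_pos hσ (Real.sqrt_pos.2 (sub_pos.2 ht))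

lemma tendsto_d₁_numerator (hx₀ : 0 < x₀) (hX : 0 < X) :
    Tendsto (fun t => Real.log (x₀⁻¹ * Real.exp (rf * t) / (Real.exp (rd * t) * X⁻¹))
      - σ ^ 2 / 2 * (T - t)) (𝓝[<] T) (𝓝 (Real.log X - Real.log x₀ + (rf - rd) * T)) := by
  simp only [log_indexing_ratio hx₀ hX]
  have h : Continuous fun t =>
      Real.log X - Real.log x₀ + (rf - rd) * t - σ ^ 2 / 2 * (T - t) := by fun_prop
  simpa using (h.tendsto T).mono_left nhdsWithin_le_nhds

lemma tendsto_d₂_of_tendsto_d₁ (hσ : 0 < σ) {l : Filter ℝ}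
    (h : Tendsto (fun t => d₁ rd rf σ x₀ T X t + σ * Real.sqrt (T - t)) (𝓝[<] T) l) :
    Tendsto (fun t => d₂ rd rf σ x₀ T X t) (𝓝[<] T) l := by
  refine h.congr' ?_
  filter_upwards [self_mem_nhdsWithin] with t ht
  exact (d₂_eq_d₁_add hσ ht).symm

lemma tendsto_d₁_of_pos (hσ : 0 < σ) (hx₀ : 0 < x₀) (hX : 0 < X)
    (hL : 0 < Real.log X - Real.log x₀ + (rf - rd) * T) :
    Tendsto (fun t => d₁ rd rf σ x₀ T X t) (𝓝[<] T) atTop :=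
  (tendsto_d₁_numerator hx₀ hX).pos_mul_atTop hL (tendsto_volatility_inv hσ)

lemma tendsto_d₁_of_neg (hσ : 0 < σ) (hx₀ : 0 < x₀) (hX : 0 < X)
    (hL : Real.log X - Real.log x₀ + (rf - rd) * T < 0) :
    Tendsto (fun t => d₁ rd rf σ x₀ T X t) (𝓝[<] T) atBot :=
  (tendsto_d₁_numerator hx₀ hX).neg_mul_atTop hL (tendsto_volatility_inv hσ)

lemma tendsto_d₁_of_eq_zero (hσ : 0 < σ) (hx₀ : 0 < x₀) (hX : 0 < X)
    (hL : Real.log X - Real.log x₀ + (rf - rd) * T = 0) :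
    Tendsto (fun t => d₁ rd rf σ x₀ T X t) (𝓝[<] T) (𝓝 0) := by
  have h := (tendsto_volatility (σ := σ) (T := T)).const_mul (-((rf - rd) / σ ^ 2 + 1 / 2))
  rw [mul_zero] at h
  refine h.congr' ?_
  filter_upwards [self_mem_nhdsWithin] with t ht
  have hs : 0 < Real.sqrt (T - t) := Real.sqrt_pos.2 (sub_pos.2 ht)
  have hsq : Real.sqrt (T - t) ^ 2 = T - t := Real.sq_sqrt (sub_pos.2 ht).le
  rw [d₁, log_indexing_ratio hx₀ hX, eq_div_iff (by positivity)]
  field_simp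
  rw [hsq]
  linear_combination (-2) * hL

lemma tendsto_indexingPrice (hσ : 0 < σ) (hx₀ : 0 < x₀) (hX : 0 < X) :
    Tendsto (fun t => indexingPrice rd rf σ x₀ T X t) (𝓝[<] T)
      (𝓝 (max (Real.exp (rd * T) * X⁻¹) (x₀⁻¹ * Real.exp (rf * T)))) := by
  have hA : Tendsto (fun t => Real.exp (rd * t) * X⁻¹) (𝓝[<] T) (𝓝 (Real.exp (rd * T) * X⁻¹)) :=
    (Continuous.tendsto (by fun_prop) T).mono_left nhdsWithin_le_nhds
  have hB : Tendsto (fun t => x₀⁻¹ * Real.exp (rf * t)) (𝓝[<] T) (𝓝 (x₀⁻¹ * Real.exp (rf * T))) :=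
    (Continuous.tendsto (by fun_prop) T).mono_left nhdsWithin_le_nhds
  have hratio : x₀⁻¹ * Real.exp (rf * T) = Real.exp (rd * T) * X⁻¹ *
      Real.exp (Real.log X - Real.log x₀ + (rf - rd) * T) := by
    rw [← log_indexing_ratio hx₀ hX, Real.exp_log (by positivity),
      mul_div_cancel₀ _ (by positivity)]
  have hApos : 0 < Real.exp (rd * T) * X⁻¹ := by positivity
  have key {a b : ℝ} (h₁ : Tendsto (fun t => normCDF (-(d₁ rd rf σ x₀ T X t))) (𝓝[<] T) (𝓝 a))
      (h₂ : Tendsto (fun t => normCDF (d₂ rd rf σ x₀ T X t)) (𝓝[<] T) (𝓝 b))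
      (hmax : max (Real.exp (rd * T) * X⁻¹) (x₀⁻¹ * Real.exp (rf * T))
        = Real.exp (rd * T) * X⁻¹ * a + x₀⁻¹ * Real.exp (rf * T) * b) :
      Tendsto (fun t => indexingPrice rd rf σ x₀ T X t) (𝓝[<] T)
        (𝓝 (max (Real.exp (rd * T) * X⁻¹) (x₀⁻¹ * Real.exp (rf * T)))) := by
    rw [hmax]
    exact (hA.mul h₁).add (hB.mul h₂)
  rcases lt_trichotomy (Real.log X - Real.log x₀ + (rf - rd) * T) 0 with hL | hL | hL
  · have h := tendsto_d₁_of_neg hσ hx₀ hX hL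
    refine key (tendsto_normCDF_atTop.comp (tendsto_neg_atBot_atTop.comp h))
      (tendsto_normCDF_atBot.comp
        (tendsto_d₂_of_tendsto_d₁ hσ (h.atBot_add tendsto_volatility))) ?_
    rw [max_eq_left]
    · ring
    · rw [hratio]
      exact mul_le_of_le_one_right hApos.le (Real.exp_le_one_iff.2 hL.le)
  · have h := tendsto_d₁_of_eq_zero hσ hx₀ hX hL
    have h₂ := h.add (tendsto_volatility (σ := σ))
    have h₁ := h.neg
    rw [add_zero] at h₂
    rw [neg_zero] at h₁
    have hN := (hasDerivAt_normCDF 0).continuousAt.tendsto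
    rw [normCDF_zero] at hN
    refine key (hN.comp h₁) (hN.comp (tendsto_d₂_of_tendsto_d₁ hσ h₂)) ?_
    rw [hratio, hL, Real.exp_zero, mul_one, max_self]
    ring
  · have h := tendsto_d₁_of_pos hσ hx₀ hX hL
    refine key (tendsto_normCDF_atBot.comp (tendsto_neg_atTop_atBot.comp h))
      (tendsto_normCDF_atTop.comp
        (tendsto_d₂_of_tendsto_d₁ hσ (h.atTop_add tendsto_volatility))) ?_
    rw [max_eq_right]
    · ring
    · rw [hratio]
      exact le_mul_of_one_le_right hApos.le (Real.one_le_exp hL.le)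

end Price

/-- **Theorem 4.** The foreign price of the savings plan that provides a choice of indexing,
`V_f(X,t) = e^{r_d t} X⁻¹ N(−d₁) + x₀⁻¹ e^{r_f t} N(d₂)`, solves the Black–Scholes-type
equation with drift `σ² + r_d − r_f` and rate `r_f`, and attains the terminal payoff
`max(e^{r_d T} X⁻¹, x₀⁻¹ e^{r_f T})` at expiry. -/
theorem savings_plan_choice_of_indexing_price (rd rf σ x₀ T : ℝ)
    (hσ : 0 < σ) (hx₀ : 0 < x₀) (hT : 0 < T)
    (Vf : ℝ → ℝ → ℝ)
    (hVf : ∀ X t : ℝ, 0 < X → t < T →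
      Vf X t = Real.exp (rd * t) * X⁻¹ * normCDF (-(d₁ rd rf σ x₀ T X t))
        + x₀⁻¹ * Real.exp (rf * t) * normCDF (d₂ rd rf σ x₀ T X t)) :
    (∀ X t : ℝ, 0 < X → t < T →
      deriv (fun u => Vf X u) t
        + σ ^ 2 / 2 * X ^ 2 * deriv (fun y => deriv (fun z => Vf z t) y) X
        + (σ ^ 2 + rd - rf) * X * deriv (fun y => Vf y t) X
        - rf * Vf X t = 0) ∧
    (∀ X : ℝ, 0 < X →
      Tendsto (fun t => Vf X t) (𝓝[<] T)
        (𝓝 (max (Real.exp (rd * T) * X⁻¹) (x₀⁻¹ * Real.exp (rf * T))))) := by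
  have hV (X t : ℝ) (hX : 0 < X) (ht : t < T) : Vf X t = indexingPrice rd rf σ x₀ T X t :=
    hVf X t hX ht
  constructor
  · intro X t hX ht
    have hfst (y : ℝ) (hy : 0 < y) : deriv (fun z => Vf z t) y =
        -(Real.exp (rd * t) * (y ^ 2)⁻¹ * normCDF (-(d₁ rd rf σ x₀ T y t))) := by
      refine ((hasDerivAt_indexingPrice_fst hσ hx₀ hy ht).congr_of_eventuallyEq ?_).deriv
      filter_upwards [lt_mem_nhds hy] with z hz using hV z t hz ht
    have hsecond := ((hasDerivAt_deriv_indexingPrice_fst (rd := rd) (rf := rf) (T := T) (t := t)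
      hσ hx₀ hX).congr_of_eventuallyEq
        ((lt_mem_nhds hX).mono fun y hy => hfst y hy)).deriv
    have hsnd : deriv (fun u => Vf X u) t = _ :=
      ((hasDerivAt_indexingPrice_snd (rd := rd) (rf := rf) hσ hx₀ hX ht).congr_of_eventuallyEq
        ((gt_mem_nhds ht).mono fun u hu => hV X u hX hu)).deriv
    have hs : 0 < Real.sqrt (T - t) := Real.sqrt_pos.2 (by linarith)
    have hpi := sqrt_two_mul_pi_pos
    rw [hsnd, hsecond, hfst X hX, hV X t hX ht, indexingPrice]
    generalize Real.sqrt (2 * Real.pi) = p at *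
    field_simp
    ring
  · intro X hX
    refine (tendsto_indexingPrice hσ hx₀ hX).congr' ?_
    filter_upwards [self_mem_nhdsWithin] with t ht
    exact (hV X t hX ht).symm
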